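/- arXiv:2206.02385 — 5 statements merged into one kernel-verified Lean document; each statement's English description precedes it below -/
import Mathlib

section
/- If G is a self-complementary simple graph on n vertices with n > 3, then G has a Hamiltonian path. -/
/-- If no consecutive pair `(a, b)` of a nonempty list satisfies `p a ∧ q b`, the last entry fails
`p` and the first one fails `q`, then `p` and `q` together hold fewer times than the length. -/
theorem List.IsChain.countP_add_countP_lt_length {α : Type*} {p q : α → Bool} {x : α} {t : List α}
    (h : (x :: t).IsChain fun a b => ¬(p a = true ∧ q b = true))
    (hp : ∀ z ∈ (x :: t).getLast?, p z = false) (hq : q x = false) :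
    (x :: t).countP p + (x :: t).countP q < (x :: t).length := by
  rw [List.countP_cons_of_neg (p := q) (by simp [hq])]
  clear hq
  induction t generalizing x with
  | nil => simp_all
  | cons y t ih =>
    rw [List.isChain_cons_cons] at h
    have := ih h.2 (by simpa [List.getLast?_cons_cons] using hp)
    rw [List.countP_cons (p := p) (a := x), List.countP_cons (p := q) (a := y)]
    have h1 := h.1
    simp only [List.length_cons] at *
    split_ifs <;> first | omega | exact absurd ⟨‹_›, ‹_›⟩ h1

namespace SimpleGraph

variable {V : Type*} {G H : SimpleGraph V}

/-- A list through all vertices, each exactly once, with consecutive vertices adjacent. -/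
def IsHamiltonianList (G : SimpleGraph V) (l : List V) : Prop :=
  l.Nodup ∧ (∀ v, v ∈ l) ∧ l.IsChain G.Adj

theorem IsHamiltonianList.exists_isHamiltonian [DecidableEq V] [Nonempty V] {l : List V}
    (h : G.IsHamiltonianList l) : ∃ (u v : V) (p : G.Walk u v), p.IsHamiltonian := by
  have hne : l ≠ [] := List.ne_nil_of_mem (h.2.1 (Classical.arbitrary V))
  refine ⟨_, _, Walk.ofSupport l hne h.2.2, fun a => ?_⟩
  rw [Walk.support_ofSupport]
  exact List.count_eq_one_of_mem h.1 (h.2.1 a)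

/-- The path rotation argument: if two disjoint paths, the first ending in `u` and the second
starting in `v`, cover all vertices of a graph without Hamiltonian path, then `u` and `v` together
have few neighbours on the first one. -/
theorem countP_adj_add_countP_adj_lt_length [DecidableRel H.Adj]
    (hH : ∀ l, ¬ H.IsHamiltonianList l) {A B : List V} {u v : V}
    (hnd : (A ++ B).Nodup) (hmem : ∀ z, z ∈ A ++ B) (hA : A.IsChain H.Adj)
    (hB : B.IsChain H.Adj) (hu : A.getLast? = some u) (hv : B.head? = some v) :
    A.countP (fun z => H.Adj u z) + A.countP (fun z => H.Adj v z) < A.length := by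
  have hsymm : ∀ {l : List V}, l.reverse.IsChain H.Adj ↔ l.IsChain H.Adj := by
    intro l
    rw [List.isChain_reverse]
    simp only [H.adj_comm]
  cases A with
  | nil => simp at hu
  | cons a t =>
    apply List.IsChain.countP_add_countP_lt_length
    · rw [List.isChain_iff_forall_rel_of_append_cons_cons]
      intro x y l₁ l₂ hl hxy
      simp only [decide_eq_true_eq] at hxy
      rw [hl] at hnd hmem hA hu
      rw [List.isChain_append_cons_cons] at hA
      apply hH (l₁ ++ [x] ++ (y :: l₂).reverse ++ B)
      refine ⟨?_, ?_, ?_⟩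
      · refine (List.Perm.nodup_iff ?_).1 hnd
        simp only [List.append_assoc, List.cons_append, List.nil_append]
        refine List.Perm.append_left _ (List.Perm.cons _ ?_)
        exact (List.reverse_perm (y :: l₂)).symm.append_right B
      · intro z
        have := hmem z
        simp only [List.mem_append, List.mem_reverse, List.mem_cons, List.not_mem_nil] at this ⊢
        tauto
      · rw [List.isChain_append, List.isChain_append]
        refine ⟨⟨hA.1, hsymm.2 hA.2.2, ?_⟩, hB, ?_⟩
        · intro r hr s hs
          simp only [List.getLast?_append, List.head?_reverse] at hr hs hu
          simp_all
          grind [H.adj_comm]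
        · intro r hr s hs
          rw [List.append_assoc, List.getLast?_append, List.reverse_cons, ← List.append_assoc,
            List.getLast?_concat] at hr
          simp_all [H.adj_comm]
    · intro z hz
      simp_all
    · by_contra hadj
      apply hH ((a :: t).reverse ++ B)
      refine ⟨?_, ?_, ?_⟩
      · exact (List.Perm.nodup_iff ((List.reverse_perm _).symm.append_right B)).1 hnd
      · intro z
        simpa only [List.mem_append, List.mem_reverse] using hmem z
      · rw [List.isChain_append]
        refine ⟨hsymm.2 hA, hB, ?_⟩
        intro r hr s hs
        simp_all [H.adj_comm]

/-- The Bondy–Chvátal closure step for Hamiltonian paths. -/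
theorem degree_add_degree_add_two_le_card [Fintype V] [DecidableEq V] [DecidableRel H.Adj]
    (hH : ∀ l, ¬ H.IsHamiltonianList l) {u v : V} (huv : ∃ l, (H ⊔ edge u v).IsHamiltonianList l) :
    H.degree u + H.degree v + 2 ≤ Fintype.card V := by
  obtain ⟨l, hnd, hmem, hl⟩ := huv
  have hdeg : ∀ w, l.countP (fun z => H.Adj w z) = H.degree w := by
    intro w
    rw [← H.card_neighborFinset_eq_degree, List.countP_eq_length_filter,
      ← List.toFinset_card_of_nodup (hnd.filter _)]
    congr 1
    ext z
    simp [hmem]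
  have hcard : l.length = Fintype.card V := by
    rw [← List.toFinset_card_of_nodup hnd, ← Finset.card_univ]
    congr 1
    ext z
    simp [hmem]
  obtain ⟨x, y, l₁, l₂, rfl, hxy⟩ : ∃ x y l₁ l₂, l = l₁ ++ x :: y :: l₂ ∧ ¬ H.Adj x y := by
    have := fun hc => hH l ⟨hnd, hmem, hc⟩
    rw [List.isChain_iff_forall_rel_of_append_cons_cons] at this
    by_contra! hc
    exact this fun x y l₁ l₂ h => hc x y l₁ l₂ h
  rw [List.isChain_append_cons_cons] at hl
  have hedge := hl.2.1
  simp only [sup_adj, edge_adj, hxy, false_or] at hedge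
  have hsplit : l₁ ++ x :: y :: l₂ = (l₁ ++ [x]) ++ (y :: l₂) := by simp
  rw [hsplit] at hnd hmem hdeg hcard
  have hA : (l₁ ++ [x]).IsChain H.Adj := by
    refine hl.1.imp_of_mem_imp fun a b ha hb hab => ?_
    have := List.disjoint_of_nodup_append hnd
    simp only [sup_adj, edge_adj] at hab
    grind [List.disjoint_left]
  have hB : (y :: l₂).IsChain H.Adj := by
    refine hl.2.2.imp_of_mem_imp fun a b ha hb hab => ?_
    have := List.disjoint_of_nodup_append hnd
    simp only [sup_adj, edge_adj] at hab
    grind [List.disjoint_left]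
  have h₁ := countP_adj_add_countP_adj_lt_length hH (u := x) (v := y) hnd hmem hA hB
    (by simp) (by simp)
  have h₂ := countP_adj_add_countP_adj_lt_length hH (u := y) (v := x)
    (A := (y :: l₂).reverse) (B := (l₁ ++ [x]).reverse)
    (by rw [← List.reverse_append]; exact List.nodup_reverse.2 hnd)
    (by intro z; rw [← List.reverse_append]; exact List.mem_reverse.2 (hmem z))
    (by rw [List.isChain_reverse]; simpa only [H.adj_comm] using hB)
    (by rw [List.isChain_reverse]; simpa only [H.adj_comm] using hA)
    (by simp) (by simp)
  rw [List.countP_reverse, List.countP_reverse, List.length_reverse] at h₂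
  have hx := hdeg x
  have hy := hdeg y
  rw [List.countP_append] at hx hy
  rw [List.length_append] at hcard
  rcases hedge.1 with ⟨rfl, rfl⟩ | ⟨rfl, rfl⟩ <;> omega

/-- A degree condition of Chvátal type that is forced by the absence of a Hamiltonian path. -/
theorem exists_card_degree_le_of_forall_not_isHamiltonianList [Fintype V] [DecidableEq V]
    [DecidableRel G.Adj] (hG : ∀ l, ¬ G.IsHamiltonianList l) :
    ∃ h, h + 2 ≤ Fintype.card V ∧ h + 1 ≤ ({x | G.degree x ≤ h} : Finset V).card ∧
      Fintype.card V ≤ ({x | G.degree x + h + 2 ≤ Fintype.card V} : Finset V).card + h := by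
  classical
  obtain ⟨H, hGH, hmax⟩ :=
    Finite.exists_le_maximal (p := fun K : SimpleGraph V => ∀ l, ¬ K.IsHamiltonianList l) hG
  have hmono : ∀ x, G.degree x ≤ H.degree x := fun x => degree_le_of_le hGH
  have hH := hmax.prop
  have hclosure : ∀ u v, u ≠ v → ¬ H.Adj u v → H.degree u + H.degree v + 2 ≤ Fintype.card V := by
    intro u v hne hadj
    refine degree_add_degree_add_two_le_card hH ?_
    by_contra! hc
    exact hmax.not_prop_of_gt (lt_sup_edge _ _ _ hne hadj) hc
  have hpair : ∃ e : V × V, e.1 ≠ e.2 ∧ ¬ H.Adj e.1 e.2 := by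
    by_contra! hc
    refine hH Finset.univ.toList ⟨Finset.nodup_toList _, by simp, ?_⟩
    exact (List.Pairwise.imp (fun hne => hc (_, _) hne) (Finset.nodup_toList _)).isChain
  obtain ⟨⟨u, v⟩, huv, hbest⟩ := Finset.exists_max_image
    {e : V × V | e.1 ≠ e.2 ∧ ¬ H.Adj e.1 e.2} (fun e => H.degree e.1 + H.degree e.2)
    (by obtain ⟨e, he⟩ := hpair; exact ⟨e, by simpa using he⟩)
  simp only [Finset.mem_filter, Finset.mem_univ, true_and, Prod.forall] at huv hbest
  wlog hle : H.degree u ≤ H.degree v generalizing u v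
  · refine this v u ⟨huv.1.symm, fun h => huv.2 h.symm⟩ ?_ (by omega)
    intro a b hab
    have := hbest a b hab
    omega
  have hsum := hclosure u v huv.1 huv.2
  have hcompl : ∀ w, (Hᶜ.neighborFinset w).card = Fintype.card V - 1 - H.degree w := by
    intro w
    rw [card_neighborFinset_eq_degree, degree_compl]
  refine ⟨H.degree u, by omega, ?_, ?_⟩
  · have hsub : Hᶜ.neighborFinset v ⊆ ({x | G.degree x ≤ H.degree u} : Finset V) := by
      intro x hx
      rw [mem_neighborFinset, compl_adj] at hx
      have := hbest x v ⟨hx.1.symm, fun h => hx.2 h.symm⟩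
      have := hmono x
      simp
      omega
    have := Finset.card_le_card hsub
    rw [hcompl] at this
    omega
  · have hsub : insert u (Hᶜ.neighborFinset u) ⊆
        ({x | G.degree x + H.degree u + 2 ≤ Fintype.card V} : Finset V) := by
      intro x hx
      rw [Finset.mem_insert, mem_neighborFinset, compl_adj] at hx
      have := hmono x
      simp only [Finset.mem_filter, Finset.mem_univ, true_and]
      rcases hx with rfl | hx
      · omega
      · have := hbest u x hx
        omega
    have := Finset.card_le_card hsub
    rw [Finset.card_insert_of_notMem (by simp), hcompl] at this
    omega

/-- In a self-complementary graph, degrees are distributed symmetrically. -/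
theorem card_degree_le_of_iso_compl [Fintype V] [DecidableEq V] [DecidableRel G.Adj]
    (f : G ≃g Gᶜ) (h : ℕ) :
    ({x | G.degree x ≤ h} : Finset V).card = ({x | Fintype.card V ≤ G.degree x + h + 1} : Finset V).card := by
  refine Finset.card_equiv f.toEquiv fun x => ?_
  have h₁ : Gᶜ.degree (f x) = G.degree x := f.degree_eq x
  have h₂ := G.degree_compl (f x)
  have h₃ := G.degree_lt_card_verts (f x)
  simp only [Finset.mem_filter, Finset.mem_univ, true_and, RelIso.coe_fn_toEquiv]
  omega

end SimpleGraph

/-- If `G` is a self-complementary simple graph on more than 3 vertices,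
then `G` has a Hamiltonian path. -/
theorem self_complementary_has_hamiltonian_path {V : Type*} [Fintype V] [DecidableEq V]
    (G : SimpleGraph V) (hsc : Nonempty (G ≃g Gᶜ)) (hn : 3 < Fintype.card V) :
    ∃ (u v : V) (p : G.Walk u v), p.IsHamiltonian := by
  classical
  have : Nonempty V := Fintype.card_pos_iff.1 (by omega)
  obtain ⟨f⟩ := hsc
  by_contra hG
  obtain ⟨h, hh, hlow, hhigh⟩ :=
    SimpleGraph.exists_card_degree_le_of_forall_not_isHamiltonianList (G := G)
      fun l hl => hG hl.exists_isHamiltonian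
  rw [SimpleGraph.card_degree_le_of_iso_compl f] at hlow
  have hsplit := Finset.card_filter_add_card_filter_not (s := (Finset.univ : Finset V))
    (fun x => Fintype.card V ≤ G.degree x + h + 1)
  have hnot : ∀ x, ¬ Fintype.card V ≤ G.degree x + h + 1 ↔
      G.degree x + h + 2 ≤ Fintype.card V := fun x => by omega
  simp only [hnot, Finset.card_univ] at hsplit
  omega
end

section
/- If G is a self-complementary simple graph on n vertices with n ≥ 5, then the diameter of G equals 2 or 3. -/
namespace SimpleGraph

variable {V W : Type*} {G : SimpleGraph V} {H : SimpleGraph W}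

/-- Graph homomorphisms do not increase the extended distance. -/
theorem Hom.edist_map_le (f : G →g H) (u v : V) : H.edist (f u) (f v) ≤ G.edist u v := by
  refine le_iInf fun p ↦ ?_
  simpa using (p.map f).edist_le

theorem Iso.ediam_le (f : G ≃g H) : G.ediam ≤ H.ediam := by
  refine ediam_le_of_edist_le fun u v ↦ ?_
  calc G.edist u v = G.edist (f.symm (f u)) (f.symm (f v)) := by simp
    _ ≤ H.edist (f u) (f v) := f.symm.toHom.edist_map_le _ _
    _ ≤ H.ediam := edist_le_ediam

/-- Two vertices at distance greater than two in `G` dominate the complement of `G`. -/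
theorem edist_compl_le_one_or_of_two_lt_edist {u v : V} (h : 2 < G.edist u v) (w : V) :
    Gᶜ.edist w u ≤ 1 ∨ Gᶜ.edist w v ≤ 1 := by
  obtain ⟨-, -, hcommon⟩ := two_lt_edist_iff.1 h
  have hw : ¬ (G.Adj u w ∧ G.Adj v w) := fun hw ↦ by
    simpa [hcommon] using (mem_commonNeighbors (G := G)).2 hw
  simp only [edist_le_one_iff_adj_or_eq, compl_adj, G.adj_comm w]
  tauto

/-- If `G` has diameter greater than two, its complement has diameter at most three. -/
theorem ediam_compl_le_three (h : 2 < G.ediam) : Gᶜ.ediam ≤ 3 := by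
  obtain ⟨u, v, huv⟩ : ∃ u v, 2 < G.edist u v := by
    by_contra! hle
    exact h.not_ge (ediam_le_of_edist_le hle)
  have hadj : Gᶜ.edist u v ≤ 1 := by
    obtain ⟨hne, hn, -⟩ := two_lt_edist_iff.1 huv
    exact edist_le_one_iff_adj_or_eq.2 (.inl ((compl_adj ..).2 ⟨hne, hn⟩))
  have path : ∀ x a b y, Gᶜ.edist x a ≤ 1 → Gᶜ.edist a b ≤ 1 → Gᶜ.edist y b ≤ 1 →
      Gᶜ.edist x y ≤ 3 := fun x a b y hxa hab hyb ↦ by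
    calc Gᶜ.edist x y ≤ Gᶜ.edist x b + Gᶜ.edist b y := SimpleGraph.edist_triangle
      _ ≤ Gᶜ.edist x a + Gᶜ.edist a b + Gᶜ.edist b y := by gcongr; exact SimpleGraph.edist_triangle
      _ ≤ 1 + 1 + 1 := add_le_add (add_le_add hxa hab) (edist_comm.trans_le hyb)
      _ = 3 := by norm_num
  refine ediam_le_of_edist_le fun x y ↦ ?_
  rcases edist_compl_le_one_or_of_two_lt_edist huv x with hx | hx <;>
    rcases edist_compl_le_one_or_of_two_lt_edist huv y with hy | hy
  · exact path x u u y hx (by simp) hy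
  · exact path x u v y hx hadj hy
  · exact path x v u y hx (edist_comm.trans_le hadj) hy
  · exact path x v v y hx (by simp) hy

end SimpleGraph

/-- If `G` is a self-complementary simple graph on at least 5 vertices, then
the diameter of `G` is 2 or 3. -/
theorem self_complementary_diam_two_or_three {V : Type*} [Fintype V]
    (G : SimpleGraph V) (hsc : Nonempty (G ≃g Gᶜ)) (hn : 5 ≤ Fintype.card V) :
    G.diam = 2 ∨ G.diam = 3 := by
  obtain ⟨f⟩ := hsc
  have : Nontrivial V := Fintype.one_lt_card_iff_nontrivial.1 (by omega)
  have hle : G.ediam ≤ 3 := by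
    rcases le_or_gt G.ediam 2 with h | h
    · exact h.trans (by norm_num)
    · exact f.ediam_le.trans (SimpleGraph.ediam_compl_le_three h)
  have htop : G.ediam ≠ ⊤ := ne_top_of_le_ne_top (by decide) hle
  have h0 : G.diam ≠ 0 := SimpleGraph.diam_ne_zero_of_ediam_ne_top htop
  have h1 : G.diam ≠ 1 := by
    rw [Ne, SimpleGraph.diam_eq_one]
    rintro rfl
    obtain ⟨u, v, huv⟩ := exists_pair_ne V
    simpa [huv] using f.map_adj_iff (v := u) (w := v)
  have h3 : G.diam ≤ 3 := ENat.toNat_le_of_le_natCast hle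
  omega
end

section
/- Let G be a simple graph of order n > 3 whose vertex degrees, listed in nondecreasing order d_1 ≤ d_2 ≤ ⋯ ≤ d_n, satisfy: for every k with k < n/2, d_k ≥ k + 1 or d_{n−k} ≥ n − k. Then G is Hamiltonian. -/
open Finset in
/-- If the `m`-th term of a sorted enumeration of the values of `f` is at least `a`, then at most
`m` values lie below `a`. -/
theorem Finset.card_filter_lt_le_of_monotone_equiv {V : Type*} [Fintype V] {n : ℕ} {e : Fin n ≃ V}
    {f : V → ℕ} (hmono : Monotone fun i => f (e i)) {m : Fin n} {a : ℕ} (h : a ≤ f (e m)) :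
    #{v | f v < a} ≤ m := by
  calc #{v | f v < a} ≤ #((Iio m).map e.toEmbedding) := by
        refine card_le_card fun v hv => ?_
        rw [mem_filter_univ] at hv
        obtain ⟨i, rfl⟩ := e.surjective v
        simp only [mem_map_equiv, Equiv.symm_apply_apply, mem_Iio]
        by_contra! hi
        have : f (e m) ≤ f (e i) := hmono hi
        omega
    _ = m := by simp

namespace SimpleGraph

open Finset

variable {V : Type*} [Fintype V] [DecidableEq V] {G : SimpleGraph V} {u v : V}

/-- Joining the ends of a Hamiltonian path gives a Hamiltonian cycle. -/
theorem Walk.IsHamiltonian.isHamiltonianCycle_cons {p : G.Walk v u} (hp : p.IsHamiltonian)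
    (h : G.Adj u v) (hV : 3 ≤ Fintype.card V) : (Walk.cons h p).IsHamiltonianCycle := by
  have hl := hp.length_eq
  rw [Walk.isHamiltonianCycle_iff_isCycle_and_length_eq, Walk.cons_isCycle_iff, Walk.length_cons]
  refine ⟨⟨hp.isPath, fun he => ?_⟩, by omega⟩
  rw [Sym2.eq_swap] at he
  have := hp.isPath.length_eq_one_of_mem_edges he
  omega

/-- The rotation of a Hamiltonian path along a pair of crossing chords. -/
theorem Walk.IsHamiltonian.exists_isHamiltonianCycle_of_crossing {p : G.Walk u v}
    (hp : p.IsHamiltonian) (hV : 3 ≤ Fintype.card V) {i : ℕ} (hi : i < p.length)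
    (hu : G.Adj u (p.getVert (i + 1))) (hv : G.Adj v (p.getVert i)) :
    ∃ (a : V) (c : G.Walk a a), c.IsHamiltonianCycle := by
  let q : G.Walk (p.getVert (i + 1)) u :=
    (p.drop (i + 1)).append (Walk.cons hv (p.take i).reverse)
  have hq : q.IsHamiltonian := by
    have hperm : q.support.Perm p.support := by
      have : q.support = p.support.drop (i + 1) ++ (p.support.take (i + 1)).reverse := by
        simp only [q, Walk.support_append, Walk.support_cons, Walk.support_reverse,
          Walk.support_take, Walk.drop_support_eq_support_drop_min, List.tail_cons]
        rw [min_eq_left hi]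
      rw [this]
      refine ((List.reverse_perm _).append_left _).trans (List.perm_append_comm.trans ?_)
      rw [List.take_append_drop]
    exact fun a => (hperm.count_eq a).trans (hp a)
  exact ⟨_, _, hq.isHamiltonianCycle_cons hu hV⟩

/-- If a graph with a Hamiltonian path has no Hamiltonian cycle, then the degrees of the ends of
the path add up to less than the order. -/
theorem Walk.IsHamiltonian.degree_add_degree_lt [DecidableRel G.Adj] {p : G.Walk u v}
    (hp : p.IsHamiltonian) (hV : 3 ≤ Fintype.card V)
    (hG : ¬ ∃ (a : V) (c : G.Walk a a), c.IsHamiltonianCycle) :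
    G.degree u + G.degree v < Fintype.card V := by
  have hl := hp.length_eq
  let A := {i ∈ range p.length | G.Adj u (p.getVert (i + 1))}
  let B := {i ∈ range p.length | G.Adj v (p.getVert i)}
  have hA : G.degree u ≤ #A := by
    rw [← card_neighborFinset_eq_degree]
    refine (card_le_card fun w hw => ?_).trans
      (card_image_le (s := A) (f := fun i => p.getVert (i + 1)))
    rw [mem_neighborFinset] at hw
    obtain ⟨j, rfl, hj⟩ := Walk.mem_support_iff_exists_getVert.1 (hp.mem_support w)
    obtain _ | j := j
    · simp at hw
    · exact mem_image.2 ⟨j, mem_filter.2 ⟨mem_range.2 hj, hw⟩, rfl⟩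
  have hB : G.degree v ≤ #B := by
    rw [← card_neighborFinset_eq_degree]
    refine (card_le_card fun w hw => ?_).trans (card_image_le (s := B) (f := p.getVert))
    rw [mem_neighborFinset] at hw
    obtain ⟨j, rfl, hj⟩ := Walk.mem_support_iff_exists_getVert.1 (hp.mem_support w)
    obtain rfl | hj := hj.eq_or_lt
    · simp at hw
    · exact mem_image.2 ⟨j, mem_filter.2 ⟨mem_range.2 hj, hw⟩, rfl⟩
  have hAB : Disjoint A B := by
    refine Finset.disjoint_left.2 fun i hiA hiB => hG ?_
    rw [mem_filter, mem_range] at hiA hiB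
    exact hp.exists_isHamiltonianCycle_of_crossing hV hiA.1 hiA.2 hiB.2
  have hcard : #A + #B ≤ p.length := by
    rw [← card_union_of_disjoint hAB, ← card_range p.length]
    exact card_le_card (union_subset (filter_subset _ _) (filter_subset _ _))
  omega

/-- If adding the edge `uv` creates a Hamiltonian cycle, then there was a Hamiltonian path
from `v` to `u`. -/
theorem exists_isHamiltonian_of_sup_edge
    (hG : ¬ ∃ (a : V) (c : G.Walk a a), c.IsHamiltonianCycle)
    (h : ∃ (a : V) (c : (G ⊔ edge u v).Walk a a), c.IsHamiltonianCycle) :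
    ∃ p : G.Walk v u, p.IsHamiltonian := by
  have mem_edgeSet_of_notMem {x y : V} {q : (G ⊔ edge u v).Walk x y} (he : s(u, v) ∉ q.edges) :
      ∀ e ∈ q.edges, e ∈ G.edgeSet := by
    intro e heq
    have hmem := q.edges_subset_edgeSet heq
    induction e with | h a b
    rw [mem_edgeSet, sup_adj, edge_adj] at hmem
    obtain hmem | ⟨⟨rfl, rfl⟩ | ⟨rfl, rfl⟩, -⟩ := hmem
    · exact hmem
    · exact absurd heq he
    · exact absurd (Sym2.eq_swap ▸ heq) he
  have key (c : (G ⊔ edge u v).Walk u u) (hc : c.IsHamiltonianCycle) (hs : c.snd = v) :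
      ∃ p : G.Walk v u, p.IsHamiltonian := by
    obtain _ | ⟨hadj, q⟩ := c
    · exact absurd rfl hc.ne_nil
    · rw [Walk.snd_cons] at hs
      subst hs
      have hq : q.IsHamiltonian :=
        (Walk.isHamiltonianCycle_iff_isCycle_and_support_count_tail_eq_one.1 hc).2
      have he := ((Walk.cons_isCycle_iff _ _).1 hc.isCycle).2
      refine ⟨q.transfer G (mem_edgeSet_of_notMem he), fun a => ?_⟩
      rw [Walk.support_transfer]
      exact hq a
  obtain ⟨a, c, hc⟩ := h
  replace hc := hc.rotate (hc.mem_support u)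
  generalize c.rotate u _ = c at hc
  by_cases he : s(u, v) ∈ c.edges
  · have hcs : v = c.snd ∨ v = c.penultimate := by
      obtain _ | ⟨hadj, q⟩ := c
      · exact absurd rfl hc.ne_nil
      · rw [Walk.edges_cons, List.mem_cons] at he
        obtain he | he := he
        · exact Or.inl ((Sym2.congr_right.1 he).trans (Walk.snd_cons q hadj).symm)
        · have hq : q.IsHamiltonian :=
            (Walk.isHamiltonianCycle_iff_isCycle_and_support_count_tail_eq_one.1 hc).2
          have hnil : ¬ q.Nil := fun hnil => by simp [Walk.edges_eq_nil.2 hnil] at he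
          rw [Walk.penultimate_cons_of_not_nil _ _ hnil]
          exact Or.inr (hq.isPath.eq_penultimate_of_mem_edges he)
    obtain hcs | hcs := hcs
    · exact key c hc hcs.symm
    · refine key c.reverse ?_ (c.snd_reverse.trans hcs.symm)
      rw [Walk.isHamiltonianCycle_iff_isCycle_and_length_eq, Walk.length_reverse]
      exact ⟨hc.isCycle.reverse, hc.length_eq⟩
  · refine absurd ⟨u, c.transfer G (mem_edgeSet_of_notMem he), ?_⟩ hG
    rw [Walk.isHamiltonianCycle_iff_isCycle_and_length_eq, Walk.length_transfer]
    exact ⟨hc.isCycle.transfer _, hc.length_eq⟩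

/-- The complete graph on at least three vertices has a Hamiltonian cycle. -/
theorem exists_isHamiltonianCycle_top (hV : 3 ≤ Fintype.card V) :
    ∃ (a : V) (c : (⊤ : SimpleGraph V).Walk a a), c.IsHamiltonianCycle := by
  have hne : (univ : Finset V).toList ≠ [] := by
    rw [← List.length_pos_iff, length_toList, card_univ]
    omega
  let p := Walk.ofSupport (G := ⊤) _ hne (nodup_toList univ).isChain
  have hp : p.IsHamiltonian :=
    (Walk.IsPath.mk' (by simp [p, nodup_toList])).isHamiltonian_of_mem (by simp [p])
  have hl := hp.length_eq
  refine ⟨_, _, hp.isHamiltonianCycle_cons (fun h => ?_) hV⟩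
  have := Walk.length_eq_zero_iff.2 (hp.isPath.nil_iff_eq.2 h.symm)
  omega

end SimpleGraph

/-- Chvátal's condition: if the degrees `d 1 ≤ d 2 ≤ ⋯ ≤ d n` of a graph of order
`n > 3` satisfy `d k ≥ k + 1` or `d (n - k) ≥ n - k` for every `k < n / 2`, then the
graph is Hamiltonian (i.e. has a Hamiltonian cycle). -/
theorem chvatal_hamiltonian {V : Type*} [Fintype V] [DecidableEq V]
    (G : SimpleGraph V) [DecidableRel G.Adj] (n : ℕ) (hcard : Fintype.card V = n)
    (hn : 3 < n) (e : Fin n ≃ V) (hmono : Monotone fun i : Fin n => G.degree (e i))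
    (hdeg : ∀ (k : ℕ) (hk1 : 1 ≤ k) (hk2 : 2 * k < n),
      k + 1 ≤ G.degree (e ⟨k - 1, by omega⟩) ∨
        n - k ≤ G.degree (e ⟨n - k - 1, by omega⟩)) :
    ∃ (a : V) (p : G.Walk a a), p.IsHamiltonianCycle := by
  classical
  subst hcard
  have hV : 3 ≤ Fintype.card V := by omega
  by_contra hG
  obtain ⟨H, hGH, hH⟩ := Finite.exists_le_maximal
    (p := fun H : SimpleGraph V => ¬ ∃ (a : V) (p : H.Walk a a), p.IsHamiltonianCycle) hG
  have path_of_not_adj {u v : V} (huv : u ≠ v) (h : ¬ H.Adj u v) :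
      ∃ p : H.Walk v u, p.IsHamiltonian := by
    refine SimpleGraph.exists_isHamiltonian_of_sup_edge hH.1 (not_not.1 fun h' => h ?_)
    exact hH.2 h' le_sup_left (Or.inr <| by simp [SimpleGraph.edge_adj, huv])
  obtain ⟨⟨u, v⟩, huv, hmax⟩ :
      ∃ x ∈ Finset.univ.filter fun x : V × V => x.1 ≠ x.2 ∧ ¬ H.Adj x.1 x.2,
      ∀ y ∈ Finset.univ.filter fun x : V × V => x.1 ≠ x.2 ∧ ¬ H.Adj x.1 x.2,
        H.degree y.1 + H.degree y.2 ≤ H.degree x.1 + H.degree x.2 := by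
    refine Finset.exists_max_image _ (fun x : V × V => H.degree x.1 + H.degree x.2) ?_
    by_contra hempty
    simp only [Finset.not_nonempty_iff_eq_empty, Finset.filter_eq_empty_iff, Finset.mem_univ,
      true_imp_iff, Prod.forall, not_and, not_not] at hempty
    obtain rfl : H = ⊤ := by
      ext a b
      exact ⟨fun h => h.ne, hempty a b⟩
    exact hH.1 (SimpleGraph.exists_isHamiltonianCycle_top hV)
  simp only [Finset.mem_filter_univ, Prod.forall, and_imp] at huv hmax
  obtain ⟨hne, hadj⟩ := huv
  wlog hle : H.degree u ≤ H.degree v generalizing u v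
  · exact this v u (fun a b h h' => (hmax a b h h').trans (add_comm _ _).le) hne.symm
      (fun h => hadj h.symm) (by omega)
  obtain ⟨p, hp⟩ := path_of_not_adj hne hadj
  have hsum := hp.degree_add_degree_lt hV hH.1
  have hpos : 0 < H.degree u := by
    rw [SimpleGraph.degree_pos_iff_exists_adj]
    have hnil : ¬ p.reverse.Nil := SimpleGraph.Walk.not_nil_of_ne hne
    exact ⟨_, p.reverse.adj_snd hnil⟩
  have compl_card (w : V) : Finset.card {x | ¬ H.Adj w x} = Fintype.card V - H.degree w := by
    rw [← Finset.compl_filter, Finset.card_compl, ← SimpleGraph.neighborFinset_eq_filter,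
      SimpleGraph.card_neighborFinset_eq_degree]
  have degree_le (w : V) : G.degree w ≤ H.degree w := SimpleGraph.degree_le_of_le hGH
  have hsmall : H.degree u ≤ Finset.card {x | G.degree x < H.degree u + 1} := by
    have : ({x | ¬ H.Adj v x} : Finset V).erase v ⊆
        ({x | G.degree x < H.degree u + 1} : Finset V) := by
      intro x hx
      rw [Finset.mem_erase, Finset.mem_filter_univ] at hx
      rw [Finset.mem_filter_univ]
      have := hmax x v hx.1 fun h => hx.2 h.symm
      have := degree_le x
      omega
    have := Finset.card_le_card this
    rw [Finset.card_erase_of_mem (by simp), compl_card] at this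
    omega
  have hlarge : Fintype.card V - H.degree u ≤
      Finset.card {x | G.degree x < Fintype.card V - H.degree u} := by
    rw [← compl_card]
    refine Finset.card_le_card fun x hx => ?_
    rw [Finset.mem_filter_univ] at hx ⊢
    rw [compl_card]
    have := degree_le x
    obtain rfl | hxu := eq_or_ne u x
    · omega
    · have := hmax u x hxu hx
      omega
  obtain h | h := hdeg (H.degree u) hpos (by omega)
  · have : Finset.card {x | G.degree x < H.degree u + 1} ≤ H.degree u - 1 :=
      Finset.card_filter_lt_le_of_monotone_equiv (f := fun x => G.degree x) hmono h
    omega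
  · have : Finset.card {x | G.degree x < Fintype.card V - H.degree u} ≤
        Fintype.card V - H.degree u - 1 :=
      Finset.card_filter_lt_le_of_monotone_equiv (f := fun x => G.degree x) hmono h
    omega
end

section
/- Let G be a simple graph of order n ≥ 2 whose vertex degrees, listed in nondecreasing order d_1 ≤ d_2 ≤ ⋯ ≤ d_n, satisfy: for every k with k < (n+1)/2, d_k ≥ k or d_{n+1−k} ≥ n − k. Then G has a Hamiltonian path. -/
/-- In a list without consecutive entries `x, y` such that `p x` and `q y`, whose last entry
fails `p` and whose first entry is not counted for `q`, the two counts are disjoint up to a shift. -/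
theorem List.countP_cons_add_countP_lt_of_isChain {α : Type*} (p q : α → Bool) (x : α)
    (l : List α) (hchain : (x :: l).IsChain fun a b => ¬(p a = true ∧ q b = true))
    (hlast : ∀ a ∈ (x :: l).getLast?, p a = false) :
    (x :: l).countP p + l.countP q + 1 ≤ (x :: l).length := by
  induction l generalizing x with
  | nil => simp_all
  | cons y l ih =>
    rw [List.isChain_cons_cons] at hchain
    have := ih y hchain.2 (by simpa using hlast)
    simp only [List.countP_cons, List.length_cons] at this ⊢
    have h := hchain.1
    split_ifs at this ⊢ <;> first | omega | (exfalso; tauto)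

theorem List.countP_add_countP_lt_of_isChain {α : Type*} (p q : α → Bool)
    {l : List α} (hne : l ≠ []) (hchain : l.IsChain fun a b => ¬(p a = true ∧ q b = true))
    (hhead : ∀ a ∈ l.head?, q a = false) (hlast : ∀ a ∈ l.getLast?, p a = false) :
    l.countP p + l.countP q + 1 ≤ l.length := by
  cases l with
  | nil => exact absurd rfl hne
  | cons x l =>
    have := List.countP_cons_add_countP_lt_of_isChain p q x l hchain hlast
    have hx : q x = false := hhead x (by simp)
    simpa [List.countP_cons, hx] using this

namespace SimpleGraph

open Finset

variable {V : Type*}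

/-- A list of vertices which traverses every vertex exactly once along edges of `G`. -/
structure IsHamiltonianList_s13 (G : SimpleGraph V) (l : List V) : Prop where
  nodup : l.Nodup
  mem : ∀ v, v ∈ l
  isChain : l.IsChain G.Adj

theorem IsHamiltonianList_s13.exists_walk [DecidableEq V] [Nonempty V] {G : SimpleGraph V}
    {l : List V} (h : G.IsHamiltonianList_s13 l) :
    ∃ (u v : V) (p : G.Walk u v), p.IsHamiltonian := by
  have hne : l ≠ [] := List.ne_nil_of_mem (h.mem (Classical.arbitrary V))
  refine ⟨_, _, Walk.ofSupport l hne h.isChain, fun v => ?_⟩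
  rw [Walk.support_ofSupport]
  exact List.count_eq_one_of_mem h.nodup (h.mem v)

theorem IsHamiltonianList_s13.reverse {G : SimpleGraph V} {l : List V}
    (h : G.IsHamiltonianList_s13 l) : G.IsHamiltonianList_s13 l.reverse where
  nodup := List.nodup_reverse.2 h.nodup
  mem v := List.mem_reverse.2 (h.mem v)
  isChain := List.isChain_reverse.2 (h.isChain.imp fun _ _ hab => hab.symm)

theorem IsHamiltonianList_s13.of_perm {G : SimpleGraph V} {l l' : List V} (hnd : l.Nodup)
    (hmem : ∀ v, v ∈ l) (hperm : l'.Perm l) (hchain : l'.IsChain G.Adj) :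
    G.IsHamiltonianList_s13 l' where
  nodup := hperm.nodup_iff.2 hnd
  mem v := hperm.mem_iff.2 (hmem v)
  isChain := hchain

theorem isChain_adj_reverse {G : SimpleGraph V} {l : List V} :
    l.reverse.IsChain G.Adj ↔ l.IsChain G.Adj := by
  rw [List.isChain_reverse]
  simp only [G.adj_comm]

theorem degree_eq_countP [Fintype V] {G : SimpleGraph V} [DecidableRel G.Adj] {l : List V}
    (hnd : l.Nodup) (hmem : ∀ v, v ∈ l) (u : V) :
    G.degree u = l.countP fun v => decide (G.Adj u v) := by
  classical
  have : G.neighborFinset u = (l.filter fun v => decide (G.Adj u v)).toFinset := by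
    ext v
    simp [hmem]
  rw [← card_neighborFinset_eq_degree, this, List.toFinset_card_of_nodup (hnd.filter _),
    List.countP_eq_length_filter]

/-- Two disjoint paths, one ending in `u` and the other starting in `v`, can be recombined into a
Hamiltonian path when they cover the graph and the degree sum of `u` and `v` is large. -/
theorem exists_isHamiltonianList_of_append [Fintype V] {G : SimpleGraph V} [DecidableRel G.Adj]
    {u v : V} {A B : List V}
    (hnd : ((A ++ [u]) ++ (v :: B)).Nodup) (hmem : ∀ w, w ∈ (A ++ [u]) ++ (v :: B))
    (hA : (A ++ [u]).IsChain G.Adj) (hB : (v :: B).IsChain G.Adj)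
    (hdeg : Fintype.card V ≤ G.degree u + G.degree v + 1) :
    ∃ l, G.IsHamiltonianList_s13 l := by
  classical
  by_contra! hno
  have hno' : ∀ l : List V, l.Perm ((A ++ [u]) ++ (v :: B)) → ¬l.IsChain G.Adj :=
    fun l hl hc => hno l (.of_perm hnd hmem hl hc)
  have hleft := List.countP_add_countP_lt_of_isChain (fun w => decide (G.Adj u w))
    (fun w => decide (G.Adj v w)) (l := A ++ [u]) (by simp)
    (by
      rw [List.isChain_iff_forall_rel_of_append_cons_cons]
      rintro x y L₁ L₂ hL ⟨hx, hy⟩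
      simp only [decide_eq_true_eq] at hx hy
      have hlast : (y :: L₂).getLast? = some u := by
        have := congrArg List.getLast? hL
        simpa using this.symm
      refine hno' ((L₁ ++ [x]) ++ ((y :: L₂).reverse ++ (v :: B))) ?_ ?_
      · rw [hL, ← List.append_assoc]
        refine List.Perm.append_right _ ?_
        rw [List.append_cons L₁ x (y :: L₂)]
        exact List.Perm.append_left _ (List.reverse_perm _)
      · rw [hL, List.append_cons, List.isChain_append] at hA
        refine List.isChain_append.2
          ⟨hA.1, List.isChain_append.2 ⟨isChain_adj_reverse.2 hA.2.1, hB, ?_⟩, ?_⟩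
        · simpa using hy.symm
        · rw [List.head?_append, List.head?_reverse, hlast]
          simpa using hx.symm)
    (by
      intro x hx
      by_contra hvx
      simp only [decide_eq_false_iff_not, not_not] at hvx
      refine hno' ((A ++ [u]).reverse ++ (v :: B))
        (List.Perm.append_right _ (List.reverse_perm _)) ?_
      rw [List.isChain_append, isChain_adj_reverse, List.getLast?_reverse]
      refine ⟨hA, hB, fun y hy z hz => ?_⟩
      obtain rfl := Option.mem_unique hx hy
      obtain rfl : v = z := by simpa using hz
      exact hvx.symm)
    (by simp)
  have hright := List.countP_add_countP_lt_of_isChain (fun w => decide (G.Adj u w))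
    (fun w => decide (G.Adj v w)) (l := v :: B) (by simp)
    (by
      rw [List.isChain_iff_forall_rel_of_append_cons_cons]
      rintro x y L₁ L₂ hL ⟨hx, hy⟩
      simp only [decide_eq_true_eq] at hx hy
      have hhead : (L₁ ++ [x]).head? = some v := by
        have := congrArg List.head? hL
        rw [List.append_cons, List.head?_append_of_ne_nil _ (by simp)] at this
        simpa using this.symm
      refine hno' ((A ++ [u]) ++ ((L₁ ++ [x]).reverse ++ (y :: L₂))) ?_ ?_
      · rw [hL]
        refine List.Perm.append_left _ ?_
        rw [List.append_cons L₁ x (y :: L₂)]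
        exact List.Perm.append_right _ (List.reverse_perm _)
      · rw [hL, List.append_cons, List.isChain_append] at hB
        refine List.isChain_append.2
          ⟨hA, List.isChain_append.2 ⟨isChain_adj_reverse.2 hB.1, hB.2.1, ?_⟩, ?_⟩
        · rw [List.getLast?_reverse, hhead]
          simpa using hy
        · simpa using hx)
    (by simp)
    (by
      intro x hx
      by_contra hux
      simp only [decide_eq_false_iff_not, not_not] at hux
      refine hno' ((A ++ [u]) ++ (v :: B).reverse)
        (List.Perm.append_left _ (List.reverse_perm _)) ?_
      rw [List.isChain_append, isChain_adj_reverse, List.head?_reverse]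
      refine ⟨hA, hB, fun y hy z hz => ?_⟩
      obtain rfl := Option.mem_unique hx hz
      obtain rfl : u = y := by simpa using hy
      exact hux)
  have hu := degree_eq_countP (G := G) hnd hmem u
  have hv := degree_eq_countP (G := G) hnd hmem v
  have hlen : Fintype.card V = ((A ++ [u]) ++ (v :: B)).length := by
    rw [← List.toFinset_card_of_nodup hnd, ← Finset.card_univ]
    congr 1
    ext w
    simp only [Finset.mem_univ, List.mem_toFinset, hmem w]
  rw [List.countP_append] at hu hv
  rw [List.length_append] at hlen
  omega

theorem isChain_adj_of_isChain_sup_edge {G : SimpleGraph V} {u v : V} {l : List V}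
    (h : l.IsChain (G ⊔ edge u v).Adj) (hl : u ∉ l ∨ v ∉ l) : l.IsChain G.Adj := by
  rw [List.isChain_iff_forall_rel_of_append_cons_cons] at h ⊢
  intro x y L₁ L₂ hL
  have hx : x ∈ l := by simp [hL]
  have hy : y ∈ l := by simp [hL]
  have := h hL
  rw [sup_adj, edge_adj] at this
  rcases this with h | ⟨⟨rfl, rfl⟩ | ⟨rfl, rfl⟩, -⟩
  · exact h
  · tauto
  · tauto

/-- The Bondy–Chvátal closure step for Hamiltonian paths. -/
theorem exists_isHamiltonianList_of_sup_edge [Fintype V] {G : SimpleGraph V}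
    [DecidableRel G.Adj] {u v : V}
    (hdeg : Fintype.card V ≤ G.degree u + G.degree v + 1)
    (h : ∃ l, (G ⊔ edge u v).IsHamiltonianList_s13 l) : ∃ l, G.IsHamiltonianList_s13 l := by
  classical
  have split : ∀ L₁ L₂ : List V,
      (G ⊔ edge u v).IsHamiltonianList_s13 (L₁ ++ u :: v :: L₂) → ∃ l, G.IsHamiltonianList_s13 l := by
    intro L₁ L₂ hl
    have hnd := hl.nodup
    have hmem := hl.mem
    have hchain := hl.isChain
    rw [List.append_cons] at hnd hmem hchain
    rw [List.isChain_append] at hchain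
    have hdisj := List.disjoint_of_nodup_append hnd
    exact exists_isHamiltonianList_of_append hnd hmem
      (isChain_adj_of_isChain_sup_edge hchain.1 (.inr fun hv => hdisj hv (by simp)))
      (isChain_adj_of_isChain_sup_edge hchain.2.1 (.inl fun hu => hdisj (by simp) hu)) hdeg
  obtain ⟨l, hl⟩ := h
  by_contra hno
  refine hno ⟨l, hl.nodup, hl.mem, ?_⟩
  rw [List.isChain_iff_forall_rel_of_append_cons_cons]
  intro x y L₁ L₂ hL
  have hxy := List.isChain_iff_forall_rel_of_append_cons_cons.1 hl.isChain hL
  rw [sup_adj, edge_adj] at hxy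
  rcases hxy with hxy | ⟨⟨rfl, rfl⟩ | ⟨rfl, rfl⟩, -⟩
  · exact hxy
  · exact absurd (split L₁ L₂ (hL ▸ hl)) hno
  · refine absurd (split L₂.reverse L₁.reverse ?_) hno
    have := hl.reverse
    rw [hL] at this
    simpa using this

open scoped Classical in
/-- Chvátal's condition for Hamiltonian paths, stated without ordering the degrees. -/
def ChvatalPathCondition [Fintype V] (G : SimpleGraph V) : Prop :=
  ∀ k : ℕ, 1 ≤ k → 2 * k < Fintype.card V + 1 →
    k ≤ #{v | G.degree v < k} → k ≤ #{v | Fintype.card V - k ≤ G.degree v}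

theorem ChvatalPathCondition.mono [Fintype V] {G H : SimpleGraph V} (hGH : G ≤ H)
    (hG : G.ChvatalPathCondition) : H.ChvatalPathCondition := by
  classical
  intro k hk₁ hk₂ hk
  refine (hG k hk₁ hk₂ (hk.trans (card_le_card fun v hv => ?_))).trans
    (card_le_card fun v hv => ?_)
  · simp only [mem_filter, mem_univ, true_and] at hv ⊢
    exact (degree_le_of_le hGH).trans_lt hv
  · simp only [mem_filter, mem_univ, true_and] at hv ⊢
    exact hv.trans (degree_le_of_le hGH)

open scoped Classical in
/-- An incomplete graph satisfying Chvátal's condition has a pair of nonadjacent vertices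
of large degree sum. -/
theorem ChvatalPathCondition.exists_not_adj [Fintype V] {G : SimpleGraph V}
    (hG : G.ChvatalPathCondition) (htop : G ≠ ⊤) :
    ∃ u v, u ≠ v ∧ ¬G.Adj u v ∧ Fintype.card V ≤ G.degree u + G.degree v + 1 := by
  by_contra! hno
  obtain ⟨a, b, hab, hnab⟩ := ne_top_iff_exists_not_adj.1 htop
  obtain ⟨⟨u, v⟩, huv, hmax⟩ := exists_max_image
    (univ.filter fun p : V × V => p.1 ≠ p.2 ∧ ¬G.Adj p.1 p.2)
    (fun p => G.degree p.1 + G.degree p.2) ⟨(a, b), by simp [hab, hnab]⟩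
  simp only [mem_filter, mem_univ, true_and, Prod.forall, and_imp] at huv hmax
  wlog hle : G.degree u ≤ G.degree v generalizing u v
  · refine this v u ⟨huv.1.symm, fun h => huv.2 h.symm⟩ (fun x y hxy hnxy => ?_) (by omega)
    have := hmax x y hxy hnxy
    omega
  obtain ⟨hne, hnadj⟩ := huv
  have hsum := hno u v hne hnadj
  have hsmall : G.degree u + 1 ≤ #{w | G.degree w < G.degree u + 1} := by
    have hsub : Gᶜ.neighborFinset v ⊆ univ.filter fun w => G.degree w < G.degree u + 1 := by
      intro w hw
      rw [mem_neighborFinset, compl_adj] at hw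
      have := hmax v w hw.1 hw.2
      simp only [mem_filter, mem_univ, true_and]
      omega
    have hcard := card_le_card hsub
    rw [card_neighborFinset_eq_degree, degree_compl] at hcard
    omega
  have hlarge := hG (G.degree u + 1) (by omega) (by omega) hsmall
  obtain ⟨w, hw, hwu⟩ : ∃ w ∈ univ.filter
      (fun w => Fintype.card V - (G.degree u + 1) ≤ G.degree w), w ∉ G.neighborFinset u := by
    apply exists_mem_notMem_of_card_lt_card
    rw [card_neighborFinset_eq_degree]
    omega
  simp only [mem_filter, mem_univ, true_and, mem_neighborFinset] at hw hwu
  have huw : u ≠ w := by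
    rintro rfl
    omega
  have := hno u w huw hwu
  omega

theorem ChvatalPathCondition.exists_isHamiltonianList [Fintype V] {G : SimpleGraph V}
    (hG : G.ChvatalPathCondition) : ∃ l, G.IsHamiltonianList_s13 l := by
  classical
  induction G using WellFoundedGT.induction with
  | ind G ih =>
    by_cases htop : G = ⊤
    · subst htop
      refine ⟨univ.toList, nodup_toList _, by simp, List.Pairwise.isChain ?_⟩
      exact (nodup_toList univ).imp fun h => h
    · obtain ⟨u, v, hne, hnadj, hdeg⟩ := hG.exists_not_adj htop
      refine exists_isHamiltonianList_of_sup_edge hdeg (ih _ ?_ (hG.mono le_sup_left))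
      exact lt_sup_edge G _ _ hne hnadj

theorem chvatalPathCondition_of_monotone [Fintype V] {G : SimpleGraph V} [DecidableRel G.Adj]
    {n : ℕ} (hcard : Fintype.card V = n) (e : Fin n ≃ V)
    (hmono : Monotone fun i : Fin n => G.degree (e i))
    (hdeg : ∀ k : ℕ, 1 ≤ k → 2 * k < n + 1 → ∀ (h₁ : k - 1 < n) (h₂ : n - k < n),
      k ≤ G.degree (e ⟨k - 1, h₁⟩) ∨ n - k ≤ G.degree (e ⟨n - k, h₂⟩)) :
    G.ChvatalPathCondition := by
  classical
  intro k hk₁ hk₂ hk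
  rw [hcard] at hk₂ ⊢
  have h₁ : k - 1 < n := by omega
  have h₂ : n - k < n := by omega
  rcases hdeg k hk₁ hk₂ h₁ h₂ with h | h
  · exfalso
    have hsub : (univ.filter fun v => G.degree v < k) ⊆
        (Iio (⟨k - 1, h₁⟩ : Fin n)).map e.toEmbedding := by
      intro v hv
      obtain ⟨i, rfl⟩ := e.surjective v
      simp only [mem_filter, mem_univ, true_and] at hv
      simp only [mem_map_equiv, Equiv.symm_apply_apply, mem_Iio]
      by_contra! hi
      have : G.degree (e _) ≤ G.degree (e i) := hmono hi
      omega
    have := card_le_card hsub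
    rw [card_map, Fin.card_Iio] at this
    have hk' : k ≤ #{v | G.degree v < k} := by convert hk
    simp only at this
    omega
  · have hsub : (Ici (⟨n - k, h₂⟩ : Fin n)).map e.toEmbedding ⊆
        (univ.filter fun v => n - k ≤ G.degree v) := by
      intro v hv
      obtain ⟨i, rfl⟩ := e.surjective v
      simp only [mem_map_equiv, Equiv.symm_apply_apply, mem_Ici] at hv
      simp only [mem_filter, mem_univ, true_and]
      exact h.trans (hmono hv)
    have := card_le_card hsub
    rw [card_map, Fin.card_Ici] at this
    have hk' : k ≤ #{v | n - k ≤ G.degree v} := by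
      simp only at this
      omega
    convert hk'

end SimpleGraph

/-- If the degrees `d 1 ≤ d 2 ≤ ⋯ ≤ d n` of a graph of order `n ≥ 2` satisfy
`d k ≥ k` or `d (n + 1 - k) ≥ n - k` for every `k < (n + 1) / 2`, then the graph
has a Hamiltonian path. -/
theorem chvatal_hamiltonian_path {V : Type*} [Fintype V] [DecidableEq V]
    (G : SimpleGraph V) [DecidableRel G.Adj] (n : ℕ) (hcard : Fintype.card V = n)
    (hn : 2 ≤ n) (e : Fin n ≃ V) (hmono : Monotone fun i : Fin n => G.degree (e i))
    (hdeg : ∀ (k : ℕ) (hk1 : 1 ≤ k) (hk2 : 2 * k < n + 1),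
      k ≤ G.degree (e ⟨k - 1, by omega⟩) ∨
        n - k ≤ G.degree (e ⟨n - k, by omega⟩)) :
    ∃ (u v : V) (p : G.Walk u v), p.IsHamiltonian := by
  have : Nonempty V := ⟨e ⟨0, by omega⟩⟩
  obtain ⟨l, hl⟩ := (SimpleGraph.chvatalPathCondition_of_monotone hcard e hmono
    fun k hk₁ hk₂ _ _ => hdeg k hk₁ hk₂).exists_isHamiltonianList
  exact hl.exists_walk
end

section
/- Let G be a simple graph of order n ≥ 3. If for every pair of non-adjacent vertices u and v of G we have d(u) + d(v) ≥ n + 1, then G is Hamiltonian-connected. -/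
/-- A graph is Hamiltonian-connected if between any two distinct vertices
there is a Hamiltonian path. -/
def SimpleGraph.IsHamiltonianConnected {V : Type*} [DecidableEq V] (G : SimpleGraph V) : Prop :=
  ∀ u v : V, u ≠ v → ∃ p : G.Walk u v, p.IsHamiltonian

namespace SimpleGraph

variable {V : Type*} (G : SimpleGraph V)

open Classical in
/-- The indices `k < N` at which consecutive terms of `f` are not adjacent. -/
noncomputable def gaps (N : ℕ) (f : ℕ → V) : Finset ℕ :=
  {k ∈ Finset.range N | ¬ G.Adj (f k) (f (k + 1))}

lemma mem_gaps {N : ℕ} {f : ℕ → V} {k : ℕ} :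
    k ∈ G.gaps N f ↔ k < N ∧ ¬ G.Adj (f k) (f (k + 1)) := by
  simp [gaps]

/-- Reversing the segment `a + 1, …, b` of an enumeration whose chords `f a, f b` and
`f (a + 1), f (b + 1)` are edges removes any gap at `a` or `b` and creates no new one. -/
lemma exists_card_gaps_lt {N a b i : ℕ} {f : ℕ → V} (hf : ∀ w, ∃ k ≤ N, f k = w)
    (hab : a < b) (hbN : b < N) (h₁ : G.Adj (f a) (f b)) (h₂ : G.Adj (f (a + 1)) (f (b + 1)))
    (hi : i = a ∨ i = b) (hgap : i ∈ G.gaps N f) :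
    ∃ g : ℕ → V, g 0 = f 0 ∧ g N = f N ∧ (∀ w, ∃ k ≤ N, g k = w) ∧
      (G.gaps N g).card < (G.gaps N f).card := by
  have h₀ : ∀ k, ∃ m, (a < k ∧ k ≤ b ∧ m = a + 1 + b - k) ∨ (¬ (a < k ∧ k ≤ b) ∧ m = k) := by
    intro k
    by_cases h : a < k ∧ k ≤ b
    · exact ⟨_, .inl ⟨h.1, h.2, rfl⟩⟩
    · exact ⟨k, .inr ⟨h, rfl⟩⟩
  choose r hr using h₀
  have hrr : ∀ k, r (r k) = k := fun k => by
    have := hr k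
    have := hr (r k)
    omega
  have hgaps : ∀ k ∈ G.gaps N (f ∘ r), k ≠ a ∧ k ≠ b ∧
      (if a < k ∧ k < b then a + b - k else k) ∈ G.gaps N f := by
    intro k hk
    obtain ⟨hkN, hk⟩ := (G.mem_gaps).1 hk
    simp only [Function.comp_apply] at hk
    have hk₁ := hr k
    have hk₂ := hr (k + 1)
    refine ⟨?_, ?_, ?_⟩
    · rintro rfl
      rw [show r k = k by omega, show r (k + 1) = b by omega] at hk
      exact hk h₁
    · rintro rfl
      rw [show r k = a + 1 by omega, show r (k + 1) = k + 1 by omega] at hk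
      exact hk h₂
    · have hka : k ≠ a := by
        rintro rfl
        rw [show r k = k by omega, show r (k + 1) = b by omega] at hk
        exact hk h₁
      rw [mem_gaps]
      split_ifs with h
      · rw [show r k = a + b - k + 1 by omega, show r (k + 1) = a + b - k by omega] at hk
        exact ⟨by omega, fun h' => hk h'.symm⟩
      · by_cases hkb : k = b
        · subst hkb
          rw [show r k = a + 1 by omega, show r (k + 1) = k + 1 by omega] at hk
          exact absurd h₂ hk
        · rw [show r k = k by omega, show r (k + 1) = k + 1 by omega] at hk
          exact ⟨hkN, hk⟩
  refine ⟨f ∘ r, ?_, ?_, fun w => ?_, ?_⟩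
  · have := hr 0
    simp only [Function.comp_apply, show r 0 = 0 by omega]
  · have := hr N
    simp only [Function.comp_apply, show r N = N by omega]
  · obtain ⟨k, hk, rfl⟩ := hf w
    refine ⟨r k, ?_, by simp [hrr]⟩
    have := hr k
    omega
  · refine lt_of_le_of_lt ?_ (Finset.card_erase_lt_of_mem hgap)
    refine Finset.card_le_card_of_injOn (fun k => if a < k ∧ k < b then a + b - k else k) ?_ ?_
    · intro k hk
      obtain ⟨ha, hb, hmem⟩ := hgaps k hk
      refine Finset.mem_coe.2 (Finset.mem_erase.2 ⟨?_, hmem⟩)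
      dsimp only
      split_ifs <;> omega
    · intro k _ l _ hkl
      dsimp only at hkl
      split_ifs at hkl <;> omega

/-- An Ore-type degree condition at a gap of an enumeration yields a pair of crossing chords. -/
lemma exists_crossing_chords [Fintype V] [DecidableEq V] [DecidableRel G.Adj]
    {N i : ℕ} {f : ℕ → V} (hf : ∀ w, ∃ k ≤ N, f k = w) (hi : i < N)
    (hdeg : N + 2 ≤ G.degree (f i) + G.degree (f (i + 1))) :
    ∃ j < N, G.Adj (f i) (f j) ∧ G.Adj (f (i + 1)) (f (j + 1)) := by
  by_contra! hno
  set A := {j ∈ Finset.range N | G.Adj (f i) (f j)} with hA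
  set B := {j ∈ Finset.range N | G.Adj (f (i + 1)) (f (j + 1))} with hB
  have hdA : G.degree (f i) ≤ A.card + 1 := by
    rw [← G.card_neighborFinset_eq_degree]
    refine (Finset.card_le_card (t := insert (f N) (A.image f)) fun w hw => ?_).trans
      ((Finset.card_insert_le _ _).trans (Nat.succ_le_succ Finset.card_image_le))
    obtain ⟨k, hk, rfl⟩ := hf w
    rw [mem_neighborFinset] at hw
    rcases hk.eq_or_lt with rfl | hk
    · exact Finset.mem_insert_self _ _
    · exact Finset.mem_insert_of_mem (Finset.mem_image_of_mem f (by simp [hA, hk, hw]))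
  have hdB : G.degree (f (i + 1)) ≤ B.card + 1 := by
    rw [← G.card_neighborFinset_eq_degree]
    refine (Finset.card_le_card (t := insert (f 0) (B.image fun j => f (j + 1)))
      fun w hw => ?_).trans
      ((Finset.card_insert_le _ _).trans (Nat.succ_le_succ Finset.card_image_le))
    obtain ⟨k, hk, rfl⟩ := hf w
    rw [mem_neighborFinset] at hw
    rcases k with _ | k
    · exact Finset.mem_insert_self _ _
    · exact Finset.mem_insert_of_mem (Finset.mem_image.2 ⟨k, by simp [hB, hw]; omega, rfl⟩)
  have hdisj : Disjoint A B := Finset.disjoint_left.2 fun j hj hj' => by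
    simp only [hA, hB, Finset.mem_filter, Finset.mem_range] at hj hj'
    exact hno j hj.1 hj.2 hj'.2
  have hsub : A ∪ B ⊆ (Finset.range N).erase i := by
    intro j hj
    simp only [hA, hB, Finset.mem_union, Finset.mem_filter, Finset.mem_range] at hj
    refine Finset.mem_erase.2 ⟨?_, Finset.mem_range.2 (by tauto)⟩
    rintro rfl
    rcases hj with ⟨-, h⟩ | ⟨-, h⟩ <;> exact G.irrefl h
  have := Finset.card_le_card hsub
  rw [Finset.card_union_of_disjoint hdisj, Finset.card_erase_of_mem (Finset.mem_range.2 hi),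
    Finset.card_range] at this
  omega

lemma exists_walk_support_eq_map_range {f : ℕ → V} (N : ℕ)
    (h : ∀ k < N, G.Adj (f k) (f (k + 1))) :
    ∃ p : G.Walk (f 0) (f N), p.support = (List.range (N + 1)).map f := by
  induction N with
  | zero => exact ⟨.nil, by simp⟩
  | succ N ih =>
    obtain ⟨p, hp⟩ := ih fun k hk => h k (by omega)
    refine ⟨p.concat (h N (by omega)), ?_⟩
    rw [Walk.support_concat, hp, List.range_succ (n := N + 1)]
    simp

end SimpleGraph

lemma Fintype.exists_enumeration {V : Type*} [Fintype V] [DecidableEq V] {N : ℕ}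
    (hN : Fintype.card V = N + 1) {u v : V} (huv : u ≠ v) :
    ∃ f : ℕ → V, f 0 = u ∧ f N = v ∧ ∀ w, ∃ k ≤ N, f k = w := by
  have e : Fin (N + 1) ≃ V := (Fintype.equivFinOfCardEq hN).symm
  have hN₀ : Fin.last N ≠ 0 := by
    intro h
    have : Subsingleton V := by
      rw [← Fintype.card_le_one_iff_subsingleton, hN]
      have := congrArg Fin.val h
      simp at this
      omega
    exact huv (Subsingleton.elim _ _)
  obtain ⟨e₁, he₁⟩ : ∃ e₁ : Fin (N + 1) ≃ V, e₁ 0 = u :=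
    ⟨e.trans (Equiv.swap (e 0) u), by simp⟩
  obtain ⟨e₂, he₂, he₂'⟩ : ∃ e₂ : Fin (N + 1) ≃ V, e₂ 0 = u ∧ e₂ (Fin.last N) = v := by
    refine ⟨e₁.trans (Equiv.swap (e₁ (Fin.last N)) v), ?_, by simp⟩
    rw [Equiv.trans_apply, he₁, Equiv.swap_apply_of_ne_of_ne _ huv]
    rw [← he₁]
    exact fun h => hN₀ (e₁.injective h).symm
  refine ⟨fun k => e₂ (Fin.ofNat (N + 1) k), by simpa using he₂, ?_, fun w => ?_⟩
  · simpa using he₂'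
  · exact ⟨(e₂.symm w).val, by omega, by simp⟩

/-- Ore's theorem for Hamiltonian-connectedness: if `G` has order `n ≥ 3` and every
pair of non-adjacent vertices has degree sum at least `n + 1`, then `G` is
Hamiltonian-connected. -/
theorem ore_hamiltonianConnected {V : Type*} [Fintype V] [DecidableEq V]
    (G : SimpleGraph V) [DecidableRel G.Adj] (hn : 3 ≤ Fintype.card V)
    (hdeg : ∀ u v : V, u ≠ v → ¬ G.Adj u v →
      Fintype.card V + 1 ≤ G.degree u + G.degree v) :
    G.IsHamiltonianConnected := by
  intro u v huv
  obtain ⟨N, hN⟩ : ∃ N, Fintype.card V = N + 1 := ⟨Fintype.card V - 1, by omega⟩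
  have hnodup : ∀ f : ℕ → V, (∀ w, ∃ k ≤ N, f k = w) → ((List.range (N + 1)).map f).Nodup := by
    intro f hf
    rw [← Multiset.coe_nodup, ← Multiset.toFinset_card_eq_card_iff_nodup]
    have : ((List.range (N + 1)).map f : Multiset V).toFinset = Finset.univ := by
      ext w
      obtain ⟨k, hk, rfl⟩ := hf w
      simpa using ⟨k, by omega, rfl⟩
    rw [this, Finset.card_univ, hN]
    simp
  have key : ∀ c, ∀ f : ℕ → V, f 0 = u → f N = v → (∀ w, ∃ k ≤ N, f k = w) →
      (G.gaps N f).card = c → ∃ p : G.Walk u v, p.IsHamiltonian := by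
    intro c
    induction c using Nat.strong_induction_on with
    | _ c ih =>
      rintro f rfl rfl hf rfl
      rcases (G.gaps N f).eq_empty_or_nonempty with hempty | ⟨i, hi⟩
      · obtain ⟨p, hp⟩ := G.exists_walk_support_eq_map_range (f := f) N fun k hk => by
          by_contra h
          simpa [hempty] using (G.mem_gaps (N := N) (f := f)).2 ⟨hk, h⟩
        refine ⟨p, (SimpleGraph.Walk.IsPath.mk' (hp ▸ hnodup f hf)).isHamiltonian_of_mem
          fun w => ?_⟩
        obtain ⟨k, hk, rfl⟩ := hf w
        rw [hp]
        exact List.mem_map_of_mem (List.mem_range.2 (by omega))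
      · obtain ⟨hiN, hna⟩ := G.mem_gaps.1 hi
        have hne : f i ≠ f (i + 1) := fun h => by
          have := List.inj_on_of_nodup_map (hnodup f hf) (List.mem_range.2 (by omega))
            (List.mem_range.2 (by omega)) h
          omega
        obtain ⟨j, hjN, hj₁, hj₂⟩ := G.exists_crossing_chords hf hiN
          (by have := hdeg _ _ hne hna; omega)
        obtain ⟨g, hg₀, hgN, hg, hlt⟩ : ∃ g : ℕ → V, g 0 = f 0 ∧ g N = f N ∧
            (∀ w, ∃ k ≤ N, g k = w) ∧ (G.gaps N g).card < (G.gaps N f).card := by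
          rcases lt_trichotomy i j with h | rfl | h
          · exact G.exists_card_gaps_lt hf h hjN hj₁ hj₂ (.inl rfl) hi
          · exact absurd hj₁ G.irrefl
          · exact G.exists_card_gaps_lt hf h hiN hj₁.symm hj₂.symm (.inr rfl) hi
        exact ih _ hlt g hg₀ hgN hg rfl
  obtain ⟨f, hf₀, hfN, hf⟩ := Fintype.exists_enumeration hN huv
  exact key _ f hf₀ hfN hf rfl
end
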